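/- arXiv:2412.19956 — 2 statements merged into one kernel-verified Lean document; each statement's English description precedes it below -/
import Mathlib

section
/- Let γ(t) = (t, t², t³) in ℝ³. There exists an absolute constant c > 0 with the following property. Let M ≥ 1 be real, let s₁ ≥ 0, s₂ ≥ 1 and s₃ be integers with 2^{s₃} ≤ 10^{−8}·2^{s₂}, and let ξ = (ξ₁, ξ₂, ξ₃) ∈ ℝ³ satisfy M·2^{s₁+s₂+s₃−1} ≤ |ξ₃| ≤ M·2^{s₁+s₂+s₃}. Suppose t₀ ∈ [0,1] satisfies |⟨γ^{(k)}(t₀), ξ⟩| ≤ M·2^{s₁+s₂(k−1)} for k = 1, 2, 3, and additionally |⟨γ^{(2)}(t₀), ξ⟩| > M·2^{s₁+s₂−1} or |⟨γ^{(3)}(t₀), ξ⟩| > M·2^{s₁+2(s₂−1)}. Define Λ₂ := {t ∈ [0,1] : |⟨γ^{(2)}(t), ξ⟩| < 10^{−8}·M·2^{s₁+s₂} and |⟨γ^{(3)}(t), ξ⟩| < 10^{−8}·M·2^{s₁+2s₂}}. Then: (a) if 2^{s₃} < 1/100, the set Λ₂ is empty; (b) if 2^{s₃} ≥ 1/100,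 every t ∈ Λ₂ satisfies (1/100)·2^{−s₃} ≤ |t − t₀| ≤ 100·2^{−s₃} and |⟨γ^{(1)}(t), ξ⟩| ≥ c·M·2^{s₁+s₂−s₃}. -/
/-- If the second-order pairing `2ξ₂ + 6tξ₃` is of size `AB` at `t₀` and tiny at `t`, while `|ξ₃|` is
comparable to `ABX`, then `|t - t₀|` is comparable to `X⁻¹`. -/
lemma dist_mul_bounds {A B X ξ₂ ξ₃ t t₀ : ℝ} (hA : 0 < A) (hB : 0 < B)
    (h_lower : A * B * X / 2 ≤ |ξ₃|) (h_upper : |ξ₃| ≤ A * B * X)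
    (h₀ : |2 * ξ₂ + 6 * t₀ * ξ₃| ≤ A * B) (h₀' : A * B / 2 < |2 * ξ₂ + 6 * t₀ * ξ₃|)
    (ht : |2 * ξ₂ + 6 * t * ξ₃| < ((10 : ℝ) ^ 8)⁻¹ * (A * B)) :
    1 / 13 ≤ |t - t₀| * X ∧ |t - t₀| * X ≤ 1 / 2 := by
  have hAB : 0 < A * B := mul_pos hA hB
  have h_diff : 6 * |ξ₃| * |t - t₀| = |(2 * ξ₂ + 6 * t * ξ₃) - (2 * ξ₂ + 6 * t₀ * ξ₃)| := by
    rw [show (2 * ξ₂ + 6 * t * ξ₃) - (2 * ξ₂ + 6 * t₀ * ξ₃) = 6 * ξ₃ * (t - t₀) by ring,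
      abs_mul, abs_mul, abs_of_pos (by norm_num : (0 : ℝ) < 6)]
  have h_le := abs_sub (2 * ξ₂ + 6 * t * ξ₃) (2 * ξ₂ + 6 * t₀ * ξ₃)
  have h_ge := abs_sub_abs_le_abs_sub (2 * ξ₂ + 6 * t₀ * ξ₃) (2 * ξ₂ + 6 * t * ξ₃)
  rw [abs_sub_comm] at h_ge
  have h_up := mul_le_mul_of_nonneg_right h_upper (abs_nonneg (t - t₀))
  have h_lo := mul_le_mul_of_nonneg_right h_lower (abs_nonneg (t - t₀))
  norm_num at ht
  constructor
  · refine le_of_mul_le_mul_left ?_ hAB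
    linarith
  · refine le_of_mul_le_mul_left ?_ hAB
    linarith

/-- Second-order Taylor expansion at `t`, when the second-order term dominates. -/
lemma le_abs_first_pairing {A B X ξ₁ ξ₂ ξ₃ t t₀ : ℝ} (hA : 0 < A) (hB : 0 < B) (hX : 0 < X)
    (hXB : X ≤ ((10 : ℝ) ^ 8)⁻¹ * B)
    (h_lower : A * B * X / 2 ≤ |ξ₃|)
    (h₁ : |ξ₁ + 2 * t₀ * ξ₂ + 3 * t₀ ^ 2 * ξ₃| ≤ A)
    (ht : |2 * ξ₂ + 6 * t * ξ₃| < ((10 : ℝ) ^ 8)⁻¹ * (A * B))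
    (hd : 1 / 13 ≤ |t - t₀| * X) (hd' : |t - t₀| * X ≤ 1 / 2) :
    1 / 1000 * (A * B / X) ≤ |ξ₁ + 2 * t * ξ₂ + 3 * t ^ 2 * ξ₃| := by
  have hAB : 0 < A * B := mul_pos hA hB
  set D := A * B / X with hD
  have hDX : A * B = D * X := by rw [hD]; field_simp
  have hD_pos : 0 < D := div_pos hAB hX
  set d := |t - t₀| with hd_def
  have hd_nonneg : 0 ≤ d := abs_nonneg _
  have h_taylor : 3 * |ξ₃| * d ^ 2 = |(ξ₁ + 2 * t₀ * ξ₂ + 3 * t₀ ^ 2 * ξ₃)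
      - (ξ₁ + 2 * t * ξ₂ + 3 * t ^ 2 * ξ₃) + (2 * ξ₂ + 6 * t * ξ₃) * (t - t₀)| := by
    rw [show (ξ₁ + 2 * t₀ * ξ₂ + 3 * t₀ ^ 2 * ξ₃) - (ξ₁ + 2 * t * ξ₂ + 3 * t ^ 2 * ξ₃)
      + (2 * ξ₂ + 6 * t * ξ₃) * (t - t₀) = 3 * ξ₃ * (t - t₀) ^ 2 by ring,
      abs_mul, abs_mul, abs_of_pos (by norm_num : (0 : ℝ) < 3), abs_pow]
  have h_tri := (abs_add_le ((ξ₁ + 2 * t₀ * ξ₂ + 3 * t₀ ^ 2 * ξ₃)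
      - (ξ₁ + 2 * t * ξ₂ + 3 * t ^ 2 * ξ₃)) ((2 * ξ₂ + 6 * t * ξ₃) * (t - t₀)))
  have h_tri' := abs_sub (ξ₁ + 2 * t₀ * ξ₂ + 3 * t₀ ^ 2 * ξ₃) (ξ₁ + 2 * t * ξ₂ + 3 * t ^ 2 * ξ₃)
  rw [abs_mul, ← hd_def] at h_tri
  have h_quad : 3 / 2 * (D * (d * X) ^ 2) ≤ 3 * |ξ₃| * d ^ 2 := by
    have := mul_le_mul_of_nonneg_right h_lower (sq_nonneg d)
    rw [hDX] at this
    linarith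
  have h_sq : D * (1 / 13) ^ 2 ≤ D * (d * X) ^ 2 := by gcongr
  have h_lin : |2 * ξ₂ + 6 * t * ξ₃| * d ≤ ((10 : ℝ) ^ 8)⁻¹ * (D * (1 / 2)) := by
    calc |2 * ξ₂ + 6 * t * ξ₃| * d ≤ ((10 : ℝ) ^ 8)⁻¹ * (A * B) * d := by gcongr
      _ = ((10 : ℝ) ^ 8)⁻¹ * (D * (d * X)) := by rw [hDX]; ring
      _ ≤ _ := by gcongr
  have h_const : A ≤ ((10 : ℝ) ^ 8)⁻¹ * D := by
    rw [hD, ← mul_div_assoc, le_div_iff₀ hX]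
    linarith [mul_le_mul_of_nonneg_left hXB hA.le]
  norm_num at h_sq h_lin h_const
  linarith


theorem statement14 :
    ∃ c : ℝ, 0 < c ∧
      ∀ (M : ℝ), 1 ≤ M → ∀ (s₁ s₂ : ℕ) (s₃ : ℤ), 1 ≤ s₂ →
      (2:ℝ) ^ s₃ ≤ ((10:ℝ) ^ 8)⁻¹ * 2 ^ (s₂:ℤ) →
      ∀ ξ₁ ξ₂ ξ₃ : ℝ,
      M * 2 ^ ((s₁:ℤ) + (s₂:ℤ) + s₃ - 1) ≤ |ξ₃| →
      |ξ₃| ≤ M * 2 ^ ((s₁:ℤ) + (s₂:ℤ) + s₃) →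
      ∀ t₀ ∈ Set.Icc (0:ℝ) 1,
      |ξ₁ + 2 * t₀ * ξ₂ + 3 * t₀ ^ 2 * ξ₃| ≤ M * 2 ^ s₁ →
      |2 * ξ₂ + 6 * t₀ * ξ₃| ≤ M * 2 ^ (s₁ + s₂) →
      |6 * ξ₃| ≤ M * 2 ^ (s₁ + 2 * s₂) →
      (M * 2 ^ (s₁ + s₂ - 1) < |2 * ξ₂ + 6 * t₀ * ξ₃| ∨
        M * 2 ^ (s₁ + 2 * (s₂ - 1)) < |6 * ξ₃|) →
      (((2:ℝ) ^ s₃ < 1 / 100 →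
          {t ∈ Set.Icc (0:ℝ) 1 |
              |2 * ξ₂ + 6 * t * ξ₃| < ((10:ℝ) ^ 8)⁻¹ * M * 2 ^ (s₁ + s₂) ∧
              |6 * ξ₃| < ((10:ℝ) ^ 8)⁻¹ * M * 2 ^ (s₁ + 2 * s₂)} = ∅) ∧
        (1 / 100 ≤ (2:ℝ) ^ s₃ →
          ∀ t ∈ {t ∈ Set.Icc (0:ℝ) 1 |
              |2 * ξ₂ + 6 * t * ξ₃| < ((10:ℝ) ^ 8)⁻¹ * M * 2 ^ (s₁ + s₂) ∧
              |6 * ξ₃| < ((10:ℝ) ^ 8)⁻¹ * M * 2 ^ (s₁ + 2 * s₂)},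
            1 / 100 * ((2:ℝ) ^ s₃)⁻¹ ≤ |t - t₀| ∧ |t - t₀| ≤ 100 * ((2:ℝ) ^ s₃)⁻¹ ∧
            c * M * 2 ^ ((s₁:ℤ) + (s₂:ℤ) - s₃) ≤ |ξ₁ + 2 * t * ξ₂ + 3 * t ^ 2 * ξ₃|)) := by
  refine ⟨1 / 1000, by norm_num, ?_⟩
  intro M hM s₁ s₂ s₃ hs₂ hXB ξ₁ ξ₂ ξ₃ h_lower h_upper t₀ ht₀ h₁ h₂ _ h_alt
  obtain ⟨n, rfl⟩ : ∃ n, s₂ = n + 1 := ⟨s₂ - 1, by lia⟩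
  have two_ne : (2 : ℝ) ≠ 0 := two_ne_zero
  have hA : 0 < M * 2 ^ s₁ := by positivity
  have hB : (0 : ℝ) < 2 ^ (n + 1) := by positivity
  have hX : (0 : ℝ) < 2 ^ s₃ := by positivity
  have hAB := mul_pos hA hB
  rw [zpow_natCast] at hXB
  rw [zpow_sub₀ two_ne, zpow_add₀ two_ne, zpow_add₀ two_ne, zpow_natCast, zpow_natCast,
    zpow_one] at h_lower
  rw [zpow_add₀ two_ne, zpow_add₀ two_ne, zpow_natCast, zpow_natCast] at h_upper
  rw [pow_add 2 s₁, ← mul_assoc] at h₂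
  have h_half : M * 2 ^ (s₁ + (n + 1) - 1) = M * 2 ^ s₁ * 2 ^ (n + 1) / 2 := by
    rw [show s₁ + (n + 1) - 1 = s₁ + n by lia]; ring
  have h_quarter : M * 2 ^ (s₁ + 2 * (n + 1 - 1)) =
      M * 2 ^ s₁ * 2 ^ (n + 1) * 2 ^ (n + 1) / 4 := by
    rw [show n + 1 - 1 = n by lia]; ring
  rw [h_half, h_quarter] at h_alt
  rw [zpow_sub₀ two_ne, zpow_add₀ two_ne, zpow_natCast, zpow_natCast]
  simp only [pow_add (2 : ℝ) s₁ (n + 1)]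
  generalize (2 : ℝ) ^ (n + 1) = B at *
  generalize (2 : ℝ) ^ s₃ = X at *
  have h_lower' : M * 2 ^ s₁ * B * X / 2 ≤ |ξ₃| := by linarith
  have h_upper' : |ξ₃| ≤ M * 2 ^ s₁ * B * X := by linarith
  have h₂' : M * 2 ^ s₁ * B / 2 < |2 * ξ₂ + 6 * t₀ * ξ₃| := by
    refine h_alt.resolve_right fun h => ?_
    rw [abs_mul, abs_of_pos (by norm_num : (0 : ℝ) < 6)] at h
    have := mul_le_mul_of_nonneg_left hXB hAB.le
    have := mul_pos hAB hB
    norm_num at *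
    linarith
  have key : ∀ t, |2 * ξ₂ + 6 * t * ξ₃| < ((10 : ℝ) ^ 8)⁻¹ * M * (2 ^ s₁ * B) →
      |2 * ξ₂ + 6 * t * ξ₃| < ((10 : ℝ) ^ 8)⁻¹ * (M * 2 ^ s₁ * B) := fun t h => by
    linarith
  constructor
  · intro hX_lt
    refine Set.eq_empty_iff_forall_notMem.2 ?_
    rintro t ⟨ht, h, -⟩
    have hd := (dist_mul_bounds hA hB h_lower' h_upper' h₂ h₂' (key t h)).1
    have h_dist : |t - t₀| ≤ 1 := abs_le.2 ⟨by linarith [ht.1, ht₀.2], by linarith [ht.2, ht₀.1]⟩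
    linarith [mul_le_mul_of_nonneg_right h_dist hX.le]
  · rintro - t ⟨-, h, -⟩
    obtain ⟨hd, hd'⟩ := dist_mul_bounds hA hB h_lower' h_upper' h₂ h₂' (key t h)
    refine ⟨?_, ?_, ?_⟩
    · rw [← div_eq_mul_inv, div_le_iff₀ hX]
      linarith
    · rw [← div_eq_mul_inv, le_div_iff₀ hX]
      linarith
    · refine le_trans (le_of_eq ?_)
        (le_abs_first_pairing hA hB hX hXB h_lower' h₁ (key t h) hd hd')
      ring
end

section
/- Let d ≥ 2 and 1 ≤ p < ∞. There exists a constant c > 0 depending only on d and p such that for every finite Borel measure μ on ℝ^d whose support is contained in Γ_d, every x₀ ∈ ℝ^d, and every r ∈ (0,1], one has ∫_{ℝ^d} |∫_{B(x₀,r)} e^{−2πi⟨ξ,x⟩} dμ(x)|^p dξ ≥ c · μ(B(x₀,r))^p · r^{−d(d+1)/2}. -/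
open MeasureTheory ENNReal

/-- The moment curve `Γ_d = {(t, t², …, t^d) : t ∈ [0,1]}` in `ℝ^d`. -/
def momentCurve (d : ℕ) : Set (EuclideanSpace ℝ (Fin d)) :=
  {x | ∃ t ∈ Set.Icc (0:ℝ) 1, ∀ i : Fin d, x i = t ^ (i.1 + 1)}

/-- The (topological) support of a measure: points all of whose open neighborhoods have
positive measure. -/
def msupport {X : Type*} [TopologicalSpace X] [MeasurableSpace X]
    (μ : MeasureTheory.Measure X) : Set X :=
  {x | ∀ U : Set X, IsOpen U → x ∈ U → μ U ≠ 0}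

theorem measure_compl_eq_zero_of_msupport_subset {X : Type*} [TopologicalSpace X]
    [SecondCountableTopology X] [MeasurableSpace X] {μ : Measure X} {s : Set X}
    (h : msupport μ ⊆ s) : μ sᶜ = 0 := by
  refine measure_null_of_locally_null _ fun x hx => ?_
  have hx' : x ∉ msupport μ := fun h' => hx (h h')
  simp only [msupport, Set.mem_ofPred_eq, not_forall, not_not] at hx'
  obtain ⟨U, hU, hxU, hμ⟩ := hx'
  exact ⟨U, mem_nhdsWithin_of_mem_nhds (hU.mem_nhds hxU), hμ⟩

/-- If a phase varies by at most `π / 3`, its oscillatory integral has no significant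
cancellation. -/
theorem half_measure_le_norm_integral_exp {X : Type*} [MeasurableSpace X] {ν : Measure X}
    [IsFiniteMeasure ν] {φ : X → ℝ} (hφ : Measurable φ) (a : ℝ)
    (h : ∀ᵐ x ∂ν, |φ x - a| ≤ Real.pi / 3) :
    ν.real Set.univ / 2 ≤ ‖∫ x, Complex.exp (Complex.I * (φ x : ℂ)) ∂ν‖ := by
  have hint : Integrable (fun x => Complex.exp (Complex.I * ((φ x - a : ℝ) : ℂ))) ν := by
    refine Integrable.of_bound (C := 1) (by fun_prop) (.of_forall fun x => ?_)
    rw [mul_comm, Complex.norm_exp_ofReal_mul_I]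
  have hfac : ∫ x, Complex.exp (Complex.I * (φ x : ℂ)) ∂ν =
      Complex.exp (Complex.I * (a : ℂ)) *
        ∫ x, Complex.exp (Complex.I * ((φ x - a : ℝ) : ℂ)) ∂ν := by
    rw [← integral_const_mul]
    congr 1
    ext x
    rw [← Complex.exp_add]
    congr 1
    push_cast
    ring
  have hre : ∀ θ : ℝ, RCLike.re (Complex.exp (Complex.I * (θ : ℂ))) = Real.cos θ := fun θ => by
    rw [mul_comm]
    exact Complex.exp_ofReal_mul_I_re θ
  rw [hfac, norm_mul, mul_comm Complex.I, Complex.norm_exp_ofReal_mul_I, one_mul]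
  refine le_trans ?_ (Complex.re_le_norm _)
  have hreint := integral_re hint
  refine le_trans ?_ hreint.le
  calc ν.real Set.univ / 2 = ∫ _, (1 / 2 : ℝ) ∂ν := by
        rw [integral_const, smul_eq_mul]; ring
    _ ≤ _ := by
        refine integral_mono_ae (integrable_const _) hint.re ?_
        filter_upwards [h] with x hx
        rw [hre, ← Real.cos_abs, ← Real.cos_pi_div_three]
        exact Real.cos_le_cos_of_nonneg_of_le_pi (abs_nonneg _)
          (by linarith [Real.pi_pos]) hx

/-- The matrix whose `j`-th row is the `(j+1)`-st Taylor coefficient of the moment curve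
at `t`. -/
def momentTaylorMatrix (d : ℕ) (t : ℝ) : Matrix (Fin d) (Fin d) ℝ :=
  Matrix.of fun j i => ((i.1 + 1).choose (j.1 + 1) : ℝ) * t ^ (i.1 - j.1)

theorem det_momentTaylorMatrix (d : ℕ) (t : ℝ) : (momentTaylorMatrix d t).det = 1 := by
  rw [Matrix.det_of_isUpperTriangular]
  · simp [momentTaylorMatrix]
  · intro j i hij
    have : i.1 < j.1 := hij
    simp [momentTaylorMatrix, Nat.choose_eq_zero_of_lt (show i.1 + 1 < j.1 + 1 by omega)]

theorem sum_pow_sub_pow_eq_sum_momentTaylorMatrix (d : ℕ) (t s : ℝ) (ξ : Fin d → ℝ) :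
    ∑ i, ξ i * s ^ (i.1 + 1) - ∑ i, ξ i * t ^ (i.1 + 1) =
      ∑ j : Fin d, (s - t) ^ (j.1 + 1) * (momentTaylorMatrix d t).mulVec ξ j := by
  have key : ∀ i : Fin d, s ^ (i.1 + 1) - t ^ (i.1 + 1) =
      ∑ j : Fin d, (s - t) ^ (j.1 + 1) * momentTaylorMatrix d t j i := by
    intro i
    have h := add_pow (s - t) t (i.1 + 1)
    rw [sub_add_cancel, Finset.sum_range_succ'] at h
    rw [h]
    simp only [momentTaylorMatrix, Matrix.of_apply]
    rw [Fin.sum_univ_eq_sum_range (fun j => (s - t) ^ (j + 1) *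
      (((i.1 + 1).choose (j + 1) : ℝ) * t ^ (i.1 - j))) d]
    rw [← Finset.sum_subset (Finset.range_mono (show i.1 + 1 ≤ d by omega))]
    · simp only [pow_zero, Nat.sub_zero, Nat.choose_zero_right, Nat.cast_one, one_mul, mul_one,
        add_sub_cancel_right, Nat.add_sub_add_right]
      exact Finset.sum_congr rfl fun j _ => by ring
    · intro j _ hj
      rw [Nat.choose_eq_zero_of_lt (by simpa using hj)]
      simp
  simp only [Matrix.mulVec, dotProduct, Finset.mul_sum]
  rw [Finset.sum_comm, ← Finset.sum_sub_distrib]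
  refine Finset.sum_congr rfl fun i _ => ?_
  rw [← mul_sub, key, Finset.mul_sum]
  exact Finset.sum_congr rfl fun j _ => by ring

/-- The anisotropic box of frequencies dual to an arc of length `r` around `γ(t)`. -/
def dualBox (d : ℕ) (t δ r : ℝ) : Set (EuclideanSpace ℝ (Fin d)) :=
  {ξ | ∀ j : Fin d, |(momentTaylorMatrix d t).mulVec (fun i => ξ i) j| ≤ δ * (r ^ (j.1 + 1))⁻¹}

theorem measurableSet_dualBox (d : ℕ) (t δ r : ℝ) : MeasurableSet (dualBox d t δ r) := by
  simp only [dualBox, Set.ofPred_forall, Matrix.mulVec, dotProduct]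
  refine MeasurableSet.iInter fun j => measurableSet_le (Continuous.measurable ?_) measurable_const
  fun_prop

theorem volume_dualBox (d : ℕ) (t : ℝ) {δ r : ℝ} (hδ : 0 ≤ δ) (hr : 0 < r) :
    volume (dualBox d t δ r) =
      ENNReal.ofReal ((2 * δ) ^ d * (r ^ (d * (d + 1) / 2))⁻¹) := by
  set b : Fin d → ℝ := fun j => δ * (r ^ (j.1 + 1))⁻¹ with hb
  have hset : dualBox d t δ r = (WithLp.ofLp : EuclideanSpace ℝ (Fin d) → (Fin d → ℝ)) ⁻¹'
      ((Matrix.toLin' (momentTaylorMatrix d t)) ⁻¹' (Set.Icc (-b) b)) := by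
    ext ξ
    simp only [dualBox, Set.mem_ofPred_eq, Set.mem_preimage, Set.mem_Icc, Pi.le_def, abs_le,
      forall_and, Matrix.toLin'_apply, Pi.neg_apply, hb]
  have hmeas : MeasurableSet
      ((Matrix.toLin' (momentTaylorMatrix d t)) ⁻¹' (Set.Icc (-b) b)) :=
    (LinearMap.continuous_of_finiteDimensional _).measurable measurableSet_Icc
  rw [hset, (PiLp.volume_preserving_ofLp (Fin d)).measure_preimage hmeas.nullMeasurableSet,
    Measure.addHaar_preimage_linearMap _ (by simp [det_momentTaylorMatrix]),
    LinearMap.det_toLin', det_momentTaylorMatrix, Real.volume_Icc_pi,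
    ← ENNReal.ofReal_prod_of_nonneg]
  · have h1 : ∀ j, b j - (-b) j = 2 * δ * (r ^ (j.1 + 1))⁻¹ := fun j => by
      simp only [hb, Pi.neg_apply]; ring
    have h2 : ∑ j : Fin d, (j.1 + 1) = d * (d + 1) / 2 := by
      rw [Fin.sum_univ_eq_sum_range (fun j => j + 1) d]
      have := Finset.sum_range_succ' (fun j => j) d
      rw [add_zero] at this
      rw [← this, Finset.sum_range_id, Nat.add_sub_cancel, mul_comm]
    simp only [h1, Finset.prod_mul_distrib, Finset.prod_inv_distrib, Finset.prod_pow_eq_pow_sum,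
      h2]
    simp [mul_pow]
  · intro j _
    simp only [hb, Pi.neg_apply]
    have : 0 ≤ δ * (r ^ (j.1 + 1))⁻¹ := by positivity
    linarith

/-- For frequencies in the dual box, the phase varies little along the arc. -/
theorem abs_phase_sub_le_of_mem_dualBox {d : ℕ} (hd : 0 < d) {t s r : ℝ} (hr : 0 < r)
    (hs : |s - t| ≤ 2 * r) {ξ : EuclideanSpace ℝ (Fin d)}
    (hξ : ξ ∈ dualBox d t (1 / (6 * d * 2 ^ d)) r) :
    |∑ i, ξ i * s ^ (i.1 + 1) - ∑ i, ξ i * t ^ (i.1 + 1)| ≤ 1 / 6 := by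
  rw [sum_pow_sub_pow_eq_sum_momentTaylorMatrix d t s (fun i => ξ i)]
  have hd' : (0 : ℝ) < d := by exact_mod_cast hd
  calc _ ≤ ∑ j : Fin d, |(s - t) ^ (j.1 + 1) *
        (momentTaylorMatrix d t).mulVec (fun i => ξ i) j| := Finset.abs_sum_le_sum_abs _ _
    _ ≤ ∑ _j : Fin d, 1 / (6 * (d : ℝ)) := by
        refine Finset.sum_le_sum fun j _ => ?_
        rw [abs_mul, abs_pow]
        calc _ ≤ (2 * r) ^ (j.1 + 1) * (1 / (6 * d * 2 ^ d) * (r ^ (j.1 + 1))⁻¹) := by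
              gcongr
              exact hξ j
          _ = 2 ^ (j.1 + 1) * (1 / (6 * d * 2 ^ d)) := by
              rw [mul_pow]; field_simp
          _ ≤ 2 ^ d * (1 / (6 * d * 2 ^ d)) := by
              gcongr
              · norm_num
              · exact j.2
          _ = 1 / (6 * (d : ℝ)) := by field_simp
    _ = 1 / 6 := by
        rw [Finset.sum_const, Finset.card_univ, Fintype.card_fin, nsmul_eq_mul]
        field_simp

theorem statement15 (d : ℕ) (hd : 2 ≤ d) (p : ℝ) (hp : 1 ≤ p) :
    ∃ c : ℝ, 0 < c ∧
      ∀ (μ : Measure (EuclideanSpace ℝ (Fin d))), IsFiniteMeasure μ →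
        msupport μ ⊆ momentCurve d →
        ∀ (x₀ : EuclideanSpace ℝ (Fin d)) (r : ℝ), 0 < r → r ≤ 1 →
        ENNReal.ofReal (c * (μ (Metric.ball x₀ r)).toReal ^ p * (r ^ (d * (d + 1) / 2))⁻¹)
          ≤ ∫⁻ ξ : EuclideanSpace ℝ (Fin d), ENNReal.ofReal
              (‖∫ x in Metric.ball x₀ r,
                  Complex.exp (Complex.I * ((-(2 * Real.pi * ∑ i, ξ i * x i) : ℝ) : ℂ)) ∂μ‖ ^ p) := by
  have hd' : (0 : ℝ) < d := by exact_mod_cast (by omega : 0 < d)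
  set δ : ℝ := 1 / (6 * d * 2 ^ d) with hδ
  have hδpos : 0 < δ := by positivity
  refine ⟨(2 * δ) ^ d * (1 / 2) ^ p, by positivity, fun μ _ hμ x₀ r hr _ => ?_⟩
  have hae : ∀ᵐ x ∂μ.restrict (Metric.ball x₀ r), x ∈ Metric.ball x₀ r ∧ x ∈ momentCurve d :=
    (ae_restrict_mem Metric.isOpen_ball.measurableSet).and
      (ae_restrict_of_ae (measure_compl_eq_zero_of_msupport_subset hμ))
  rcases eq_or_ne (μ (Metric.ball x₀ r)) 0 with h0 | h0
  · have : (0 : ℝ) ^ p = 0 := Real.zero_rpow (by linarith)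
    simp [h0, this]
  have : (ae (μ.restrict (Metric.ball x₀ r))).NeBot := by
    rw [ae_neBot, Ne, Measure.restrict_eq_zero]
    exact h0
  obtain ⟨y, hy, t, -, hyt⟩ := hae.exists
  have hosc : ∀ ξ ∈ dualBox d t δ r, (μ (Metric.ball x₀ r)).toReal / 2 ≤
      ‖∫ x in Metric.ball x₀ r,
        Complex.exp (Complex.I * ((-(2 * Real.pi * ∑ i, ξ i * x i) : ℝ) : ℂ)) ∂μ‖ := by
    intro ξ hξ
    have hmass : (μ.restrict (Metric.ball x₀ r)).real Set.univ =
        (μ (Metric.ball x₀ r)).toReal := by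
      simp [Measure.real]
    rw [← hmass]
    refine half_measure_le_norm_integral_exp (Continuous.measurable (by fun_prop))
      (-(2 * Real.pi * ∑ i, ξ i * t ^ (i.1 + 1))) ?_
    filter_upwards [hae] with x hx
    obtain ⟨hx, s, -, hxs⟩ := hx
    have hst : |s - t| ≤ 2 * r := by
      have h1 := PiLp.norm_apply_le (x - y) (⟨0, by omega⟩ : Fin d)
      rw [PiLp.sub_apply, hxs, hyt, Real.norm_eq_abs, ← dist_eq_norm] at h1
      have h2 := dist_triangle_right x y x₀
      have h3 := Metric.mem_ball.1 hx
      have h4 := Metric.mem_ball.1 hy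
      simp only [zero_add, pow_one] at h1
      linarith
    have hph := abs_phase_sub_le_of_mem_dualBox (by omega) hr hst hξ
    simp only [hxs]
    rw [← neg_add', abs_neg, ← sub_eq_add_neg, ← mul_sub, abs_mul,
      abs_of_pos Real.two_pi_pos]
    nlinarith [Real.pi_pos]
  calc _ = ENNReal.ofReal (((μ (Metric.ball x₀ r)).toReal / 2) ^ p) *
        volume (dualBox d t δ r) := by
        rw [volume_dualBox d t hδpos.le hr, ← ENNReal.ofReal_mul (by positivity),
          div_eq_mul_one_div (μ _).toReal, Real.mul_rpow (by positivity) (by positivity)]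
        congr 1
        ring
    _ = ∫⁻ _ in dualBox d t δ r, ENNReal.ofReal (((μ (Metric.ball x₀ r)).toReal / 2) ^ p) :=
        (setLIntegral_const _ _).symm
    _ ≤ ∫⁻ ξ in dualBox d t δ r, ENNReal.ofReal
          (‖∫ x in Metric.ball x₀ r,
            Complex.exp (Complex.I * ((-(2 * Real.pi * ∑ i, ξ i * x i) : ℝ) : ℂ)) ∂μ‖ ^ p) := by
        refine setLIntegral_mono' (measurableSet_dualBox d t δ r) fun ξ hξ => ?_
        exact ENNReal.ofReal_le_ofReal
          (Real.rpow_le_rpow (by positivity) (hosc ξ hξ) (by linarith))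
    _ ≤ _ := setLIntegral_le_lintegral _ _
end
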